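/- Let a, b, ε, M be real numbers with 0 ≤ a, 0 ≤ b ≤ M, and cosh(a) ≥ cosh(b)·cosh(ε). Then a − b ≥ log(1 + e^{−M}·ε²). (This is the chain of inequalities in the proof of the peeling proposition: from cosh(AB) ≥ cosh(AC)·cosh(ε) one gets cosh(AB) − cosh(AC) ≥ ε²/2, hence e^{AB} − e^{AC} ≥ ε², hence AB − AC ≥ log(1 + e^{−AC}ε²) ≥ log(1 + e^{−M}ε²) when AC ≤ M.) -/

import Mathlib

theorem Real.one_add_sq_div_two_le_cosh (x : ℝ) : 1 + x ^ 2 / 2 ≤ Real.cosh x := by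
  have hsq : (x / 2) ^ 2 ≤ Real.sinh (x / 2) ^ 2 := by
    rw [sq_le_sq, Real.abs_sinh]
    exact Real.self_le_sinh_iff.2 (abs_nonneg _)
  have hcosh : Real.cosh x = Real.cosh (x / 2) ^ 2 + Real.sinh (x / 2) ^ 2 := by
    rw [← Real.cosh_two_mul, mul_div_cancel₀ x two_ne_zero]
  have := Real.cosh_sq (x / 2)
  linarith

/-- The chain of inequalities in the proof of the peeling proposition: if
`cosh a ≥ cosh b · cosh ε` with `0 ≤ a` and `0 ≤ b ≤ M`, then
`a - b ≥ log (1 + e^{-M} ε²)`. -/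
theorem sub_ge_log_of_cosh_ge (a b ε M : ℝ) (ha : 0 ≤ a) (hb : 0 ≤ b) (hbM : b ≤ M)
    (h : Real.cosh a ≥ Real.cosh b * Real.cosh ε) :
    a - b ≥ Real.log (1 + Real.exp (-M) * ε ^ 2) := by
  have hdiff : ε ^ 2 / 2 ≤ Real.cosh a - Real.cosh b := by
    nlinarith [Real.one_le_cosh b, Real.one_add_sq_div_two_le_cosh ε, sq_nonneg ε]
  have hba : b ≤ a := by
    rw [← abs_of_nonneg ha, ← abs_of_nonneg hb, ← Real.cosh_le_cosh]
    linarith [sq_nonneg ε]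
  have hexp : Real.exp b + ε ^ 2 ≤ Real.exp a := by
    have : Real.exp (-a) ≤ Real.exp (-b) := Real.exp_le_exp.2 (neg_le_neg hba)
    rw [Real.cosh_eq, Real.cosh_eq] at hdiff
    linarith
  rw [ge_iff_le, Real.log_le_iff_le_exp (by positivity)]
  calc 1 + Real.exp (-M) * ε ^ 2 ≤ 1 + Real.exp (-b) * ε ^ 2 := by gcongr
    _ = Real.exp (-b) * (Real.exp b + ε ^ 2) := by
      rw [mul_add, ← Real.exp_add, neg_add_cancel, Real.exp_zero]
    _ ≤ Real.exp (-b) * Real.exp a := by gcongr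
    _ = Real.exp (a - b) := by rw [← Real.exp_add, neg_add_eq_sub]
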